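/- arXiv:2206.06478 — 3 statements merged into one kernel-verified Lean document; each statement's English description precedes it below -/
import Mathlib

section
/- For every integer k ≥ 3, the cycle C_k on k vertices satisfies A_b(C_k) = 3. -/
open SimpleGraph

namespace AcyclicB

variable {V : Type*}

/-- `c` is a proper vertex coloring of `G`. -/
def Proper (G : SimpleGraph V) (c : V → ℕ) : Prop :=
  ∀ ⦃u v : V⦄, G.Adj u v → c u ≠ c v

/-- `c` is an acyclic (proper) coloring of `G`: the subgraph induced by the union of
any two color classes is a forest. -/
def IsAcyclicColoring (G : SimpleGraph V) (c : V → ℕ) : Prop :=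
  Proper G c ∧ ∀ i j : ℕ, (G.induce {v | c v = i ∨ c v = j}).IsAcyclic

/-- The closed neighborhood of `v` in `G`. -/
def closedNbhd (G : SimpleGraph V) (v : V) : Set V :=
  insert v (G.neighborSet v)

/-- `c'` is obtained from the acyclic coloring `c` by an acyclic recoloring step removing
one color `i`: every vertex of a color different from `i` keeps its color, and every vertex
of color `i` receives a color (among the colors of `c`, different from `i`) that is absent
from its closed neighborhood; the resulting coloring is again acyclic. -/
def RecolorStep (G : SimpleGraph V) (c' c : V → ℕ) : Prop :=
  IsAcyclicColoring G c ∧ IsAcyclicColoring G c' ∧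
  ∃ i ∈ Set.range c,
    (∀ v, c v ≠ i → c' v = c v) ∧
    (∀ v, c v = i → c' v ∈ Set.range c ∧ c' v ≠ i ∧
      ∀ u ∈ closedNbhd G v, c u ≠ c' v)

/-- The strict partial order `≺ₐ` on acyclic colorings: the transitive closure of the
acyclic recoloring step relation. -/
def StrictOrder (G : SimpleGraph V) : (V → ℕ) → (V → ℕ) → Prop :=
  Relation.TransGen (RecolorStep G)

/-- `c` is a minimal element of `≺ₐ`: an acyclic coloring admitting no acyclic recoloring
step. -/
def IsMinimal (G : SimpleGraph V) (c : V → ℕ) : Prop :=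
  IsAcyclicColoring G c ∧ ∀ c', ¬ RecolorStep G c' c

/-- The number of colors used by `c`. -/
def ncolors [Fintype V] (c : V → ℕ) : ℕ :=
  (Finset.univ.image c).card

/-- The acyclic b-chromatic number of `G`: the maximum number of colors used by a minimal
element of `≺ₐ`. -/
noncomputable def Ab [Fintype V] (G : SimpleGraph V) : ℕ :=
  sSup { k | ∃ c : V → ℕ, IsMinimal G c ∧ ncolors c = k }

/-- The acyclic chromatic number of `G`: the minimum number of colors in an acyclic
proper coloring. -/
noncomputable def Achrom [Fintype V] (G : SimpleGraph V) : ℕ :=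
  sInf { k | ∃ c : V → ℕ, IsAcyclicColoring G c ∧ ncolors c = k }

/-- The join of two graphs: disjoint copies of `G` and `H` together with all edges
between them. -/
def join {α β : Type*} (G : SimpleGraph α) (H : SimpleGraph β) : SimpleGraph (α ⊕ β) where
  Adj x y :=
    match x, y with
    | Sum.inl a, Sum.inl a' => G.Adj a a'
    | Sum.inr b, Sum.inr b' => H.Adj b b'
    | Sum.inl _, Sum.inr _ => True
    | Sum.inr _, Sum.inl _ => True
  symm := by
    constructor
    rintro (a | b) (a' | b') h
    · exact G.symm.symm _ _ h
    · trivial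
    · trivial
    · exact H.symm.symm _ _ h
  loopless := by
    constructor
    rintro (a | b) h
    · exact G.loopless.irrefl a h
    · exact H.loopless.irrefl b h

end AcyclicB

namespace AcyclicB

/-- A cycle in a connected graph of maximum degree at most two visits every vertex. -/
theorem mem_support_of_isCycle {G : SimpleGraph V} (hG : G.Preconnected)
    (hfin : ∀ v, (G.neighborSet v).Finite) (hdeg : ∀ v, (G.neighborSet v).ncard ≤ 2)
    {u : V} {p : G.Walk u u} (hp : p.IsCycle) (v : V) : v ∈ p.support := by
  obtain ⟨q⟩ := hG u v
  have closed : ∀ {x y : V}, x ∈ p.support → G.Adj x y → y ∈ p.support := by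
    intro x y hx hxy
    have heq : p.toSubgraph.neighborSet x = G.neighborSet x :=
      Set.eq_of_subset_of_ncard_le (p.toSubgraph.neighborSet_subset x)
        (by rw [hp.ncard_neighborSet_toSubgraph_eq_two hx]; exact hdeg x) (hfin x)
    have hy : y ∈ p.toSubgraph.neighborSet x := heq ▸ hxy
    exact p.mem_verts_toSubgraph.1 (p.toSubgraph.edge_vert hy.symm)
  have reach : ∀ {x y : V}, G.Walk x y → x ∈ p.support → y ∈ p.support := by
    intro x y q
    induction q with
    | nil => exact id
    | cons h _ ih => exact fun hx => ih (closed hx h)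
  exact reach q p.start_mem_support

theorem induce_isAcyclic_of_notMem {G : SimpleGraph V} (hG : G.Preconnected)
    (hfin : ∀ v, (G.neighborSet v).Finite) (hdeg : ∀ v, (G.neighborSet v).ncard ≤ 2)
    {s : Set V} {v : V} (hv : v ∉ s) : (G.induce s).IsAcyclic := by
  intro u p hp
  have hmap : (p.map (Embedding.induce s).toHom).IsCycle := hp.map Subtype.val_injective
  have h := mem_support_of_isCycle hG hfin hdeg hmap v
  rw [Walk.support_map, List.mem_map] at h
  obtain ⟨w, -, rfl⟩ := h
  exact hv w.2

theorem ncard_neighborSet_cycleGraph_le (n : ℕ) (v : Fin (n + 3)) :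
    ((cycleGraph (n + 3)).neighborSet v).ncard ≤ 2 := by
  rw [cycleGraph_neighborSet]
  exact (Set.ncard_insert_le _ _).trans (by rw [Set.ncard_singleton])

theorem cycleGraph_not_isAcyclic (n : ℕ) : ¬ (cycleGraph (n + 3)).IsAcyclic :=
  fun h => h _ cycleGraph.isCycle_cycle

theorem isAcyclicColoring_cycleGraph_iff (n : ℕ) (c : Fin (n + 3) → ℕ) :
    IsAcyclicColoring (cycleGraph (n + 3)) c ↔
      Proper (cycleGraph (n + 3)) c ∧ 3 ≤ ncolors c := by
  refine and_congr_right fun _ => ⟨fun h => ?_, fun h i j => ?_⟩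
  · by_contra! hlt
    obtain ⟨j, hj⟩ := Finset.card_le_one_iff_subset_singleton.1
      (show ((Finset.univ.image c).erase (c 0)).card ≤ 1 by
        rw [Finset.card_erase_of_mem (Finset.mem_image_of_mem c (Finset.mem_univ 0))]
        unfold ncolors at hlt
        omega)
    have hmem : ∀ v, v ∈ {v | c v = c 0 ∨ c v = j} := fun v =>
      or_iff_not_imp_left.2 fun hv => Finset.mem_singleton.1
        (hj (Finset.mem_erase.2 ⟨hv, Finset.mem_image_of_mem c (Finset.mem_univ v)⟩))
    refine cycleGraph_not_isAcyclic n ((h (c 0) j).comap (G := cycleGraph (n + 3))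
      ⟨fun v => ⟨v, hmem v⟩, fun h => h⟩ ?_)
    exact fun _ _ h => congrArg Subtype.val h
  · have : ∃ v, v ∉ {v | c v = i ∨ c v = j} := by
      by_contra! hall
      have hsub : Finset.univ.image c ⊆ {i, j} := by
        intro x hx
        obtain ⟨v, -, rfl⟩ := Finset.mem_image.1 hx
        simpa using hall v
      have := (Finset.card_le_card hsub).trans Finset.card_le_two
      unfold ncolors at h
      omega
    obtain ⟨v, hv⟩ := this
    exact induce_isAcyclic_of_notMem cycleGraph_preconnected (fun _ => Set.toFinite _)
      (ncard_neighborSet_cycleGraph_le n) hv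

theorem RecolorStep.ncolors_lt [Fintype V] {G : SimpleGraph V} {c' c : V → ℕ}
    (h : RecolorStep G c' c) : ncolors c' < ncolors c := by
  obtain ⟨-, -, i, ⟨w, hw⟩, hne, heq⟩ := h
  refine Finset.card_lt_card ((Finset.ssubset_iff_of_subset ?_).2 ⟨i, ?_, ?_⟩)
  · intro x hx
    obtain ⟨v, -, rfl⟩ := Finset.mem_image.1 hx
    by_cases hv : c v = i
    · simpa using (heq v hv).1
    · simp [hne v hv]
  · exact Finset.mem_image.2 ⟨w, Finset.mem_univ w, hw⟩
  · intro hi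
    obtain ⟨v, -, hv⟩ := Finset.mem_image.1 hi
    by_cases hv' : c v = i
    · exact (heq v hv').2.1 hv
    · exact hv' (hne v hv' ▸ hv)

theorem exists_color_notMem_closedNbhd {n : ℕ} {c : Fin (n + 3) → ℕ} (h : 4 ≤ ncolors c)
    (v : Fin (n + 3)) :
    ∃ a ∈ Set.range c, ∀ u ∈ closedNbhd (cycleGraph (n + 3)) v, c u ≠ a := by
  have hlt : ({c v, c (v - 1), c (v + 1)} : Finset ℕ).card < (Finset.univ.image c).card :=
    Finset.card_le_three.trans_lt h
  obtain ⟨a, ha, hna⟩ := Finset.exists_mem_notMem_of_card_lt_card hlt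
  refine ⟨a, by simpa using ha, fun u hu hua => hna ?_⟩
  rw [closedNbhd, cycleGraph_neighborSet] at hu
  obtain rfl | rfl | rfl := hu <;> simp [hua]

theorem exists_recolorStep {n : ℕ} {c : Fin (n + 3) → ℕ}
    (hc : IsAcyclicColoring (cycleGraph (n + 3)) c) (h : 4 ≤ ncolors c) :
    ∃ c', RecolorStep (cycleGraph (n + 3)) c' c := by
  choose f hf hfn using exists_color_notMem_closedNbhd h
  let c' : Fin (n + 3) → ℕ := fun v => if c v = c 0 then f v else c v
  have hadj : ∀ {u v}, (cycleGraph (n + 3)).Adj u v → c v ≠ f u := fun huv =>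
    hfn _ _ (Set.mem_insert_of_mem _ huv)
  refine ⟨c', hc, (isAcyclicColoring_cycleGraph_iff n c').2 ⟨fun u v huv => ?_, ?_⟩,
    c 0, ⟨0, rfl⟩, fun v hv => if_neg hv, fun v hv => ?_⟩
  · have huv' := hc.1 huv
    simp only [c']
    split_ifs with hu hv hv
    · exact absurd (hu.trans hv.symm) huv'
    · exact (hadj huv).symm
    · exact hadj huv.symm
    · exact huv'
  · have hsub : (Finset.univ.image c).erase (c 0) ⊆ Finset.univ.image c' := by
      intro x hx
      obtain ⟨hx0, hx⟩ := Finset.mem_erase.1 hx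
      obtain ⟨v, -, rfl⟩ := Finset.mem_image.1 hx
      exact Finset.mem_image.2 ⟨v, Finset.mem_univ v, if_neg hx0⟩
    have hcard := Finset.card_le_card hsub
    rw [Finset.card_erase_of_mem (Finset.mem_image_of_mem c (Finset.mem_univ 0))] at hcard
    unfold ncolors at h ⊢
    omega
  · have hc' : c' v = f v := if_pos hv
    rw [hc']
    exact ⟨hf v, fun h0 => hfn v v (Set.mem_insert _ _) (hv.trans h0.symm), hfn v⟩

theorem exists_proper_ncolors_eq_three (n : ℕ) :
    ∃ c : Fin (n + 3) → ℕ, Proper (cycleGraph (n + 3)) c ∧ ncolors c = 3 := by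
  let c : Fin (n + 3) → ℕ := fun v => if v = Fin.last (n + 2) then 2 else v.val % 2
  have hsucc : ∀ v, c v ≠ c (v + 1) := by
    intro v
    have hv := Fin.val_add_one v
    simp only [c]
    by_cases h : v = Fin.last (n + 2)
    · have h1 : v + 1 ≠ Fin.last (n + 2) := fun h' => by
        rw [if_pos h, h'] at hv
        simp at hv
      rw [if_pos h, if_neg h1]
      omega
    · rw [if_neg h] at hv
      rw [if_neg h, hv]
      split_ifs <;> omega
  refine ⟨c, fun u v huv => ?_, ?_⟩
  · rcases cycleGraph_adj.1 huv with h | h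
    · rw [sub_eq_iff_eq_add'.1 h]
      exact (hsucc v).symm
    · rw [sub_eq_iff_eq_add'.1 h]
      exact hsucc u
  · have himage : Finset.univ.image c = {0, 1, 2} := by
      ext x
      simp only [Finset.mem_image, Finset.mem_univ, true_and, Finset.mem_insert,
        Finset.mem_singleton]
      constructor
      · rintro ⟨v, rfl⟩
        simp only [c]
        split_ifs <;> omega
      · rintro (rfl | rfl | rfl)
        · exact ⟨0, by simp [c, Fin.ext_iff]⟩
        · exact ⟨1, by simp [c, Fin.ext_iff]⟩
        · exact ⟨Fin.last _, if_pos rfl⟩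
    rw [ncolors, himage]
    rfl

theorem isMinimal_cycleGraph_iff (n : ℕ) (c : Fin (n + 3) → ℕ) :
    IsMinimal (cycleGraph (n + 3)) c ↔ Proper (cycleGraph (n + 3)) c ∧ ncolors c = 3 := by
  constructor
  · rintro ⟨hc, hmin⟩
    obtain ⟨hp, h3⟩ := (isAcyclicColoring_cycleGraph_iff n c).1 hc
    refine ⟨hp, le_antisymm ?_ h3⟩
    by_contra! h4
    obtain ⟨c', hc'⟩ := exists_recolorStep hc h4
    exact hmin c' hc'
  · rintro ⟨hp, h3⟩
    refine ⟨(isAcyclicColoring_cycleGraph_iff n c).2 ⟨hp, h3.ge⟩, fun c' h => ?_⟩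
    have := ((isAcyclicColoring_cycleGraph_iff n c').1 h.2.1).2
    have := h.ncolors_lt
    omega

/-- For every `k ≥ 3`, the cycle on `k` vertices satisfies `A_b(C_k) = 3`. -/
theorem ab_cycleGraph (k : ℕ) (hk : 3 ≤ k) :
    Ab (SimpleGraph.cycleGraph k) = 3 := by
  obtain ⟨n, rfl⟩ := Nat.exists_eq_add_of_le' hk
  have hset : {k | ∃ c, IsMinimal (cycleGraph (n + 3)) c ∧ ncolors c = k} = {3} := by
    ext m
    constructor
    · rintro ⟨c, hc, rfl⟩
      exact ((isMinimal_cycleGraph_iff n c).1 hc).2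
    · rintro rfl
      obtain ⟨c, hc, h3⟩ := exists_proper_ncolors_eq_three n
      exact ⟨c, (isMinimal_cycleGraph_iff n c).2 ⟨hc, h3⟩, h3⟩
  rw [Ab, hset, csSup_singleton]

end AcyclicB
end

section
/- For every finite simple graph G, the acyclic b-chromatic number satisfies A_b(G) ≤ m_a(G), where m_a(G) is the m_a-degree of G defined via acyclic degrees of vertices. -/
open SimpleGraph

namespace AcyclicB

variable {V : Type*}

/-- A weak partition `{A₀, A₁, …, A_k}` of the open neighborhood of `v`: pairwise disjoint
sets covering `N(v)`, with `|A₀| ≥ 0` arbitrary and `|Aᵢ| ≥ 2` for `i ≥ 1`. -/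
structure WeakPartition (G : SimpleGraph V) (v : V) where
  k : ℕ
  A : Fin (k + 1) → Finset V
  pairwiseDisjoint : ∀ i j, i ≠ j → Disjoint (A i) (A j)
  cover : ∀ u : V, u ∈ G.neighborSet v ↔ ∃ i, u ∈ A i
  two_le : ∀ i, i ≠ 0 → 2 ≤ (A i).card

/-- The even vertices of a path `v₁ v₂ … v_{2m+1}` (of odd order, i.e. of even length):
the vertices `v₂, v₄, …, v_{2m}` occurring at even positions. -/
def evenVerts {G : SimpleGraph V} {u w : V} (p : G.Walk u w) : Set V :=
  { x | ∃ t : ℕ, 2 * t + 1 < p.length ∧ p.getVert (2 * t + 1) = x }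

/-- A qualifying path for `v` and a weak partition `P` of `N(v)`: a path of even (nonzero)
length avoiding `v` with both endpoints in one of the sets `Aᵢ`, `i ≥ 1`. -/
def QualPath (G : SimpleGraph V) (v : V) (P : WeakPartition G v)
    {u w : V} (p : G.Walk u w) : Prop :=
  p.IsPath ∧ Even p.length ∧ 0 < p.length ∧ v ∉ p.support ∧
  ∃ i : Fin (P.k + 1), i ≠ 0 ∧ u ∈ P.A i ∧ w ∈ P.A i

/-- `elp G v P`: the maximum number of pairwise even-vertex internally (EVI) disjoint
qualifying paths for `v` and `P`. -/
noncomputable def elp (G : SimpleGraph V) (v : V) (P : WeakPartition G v) : ℕ :=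
  sSup { m | ∃ F : Fin m → Σ u : V, Σ w : V, G.Walk u w,
    (∀ a, QualPath G v P (F a).2.2) ∧
    (∀ a b, a ≠ b → Disjoint (evenVerts (F a).2.2) (evenVerts (F b).2.2)) }

/-- The acyclic degree of `v`:
`dᵃ(v) = max_P (|A₀| + k + elp(v, P))` over all weak partitions `P` of `N(v)`. -/
noncomputable def aDeg (G : SimpleGraph V) (v : V) : ℕ :=
  sSup { d | ∃ P : WeakPartition G v, d = (P.A 0).card + P.k + elp G v P }

/-- The `m_a`-degree of `G`: ordering the vertices by non-increasing acyclic degree as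
`v₁, …, vₙ`, `m_a(G) = max { i : dᵃ(vᵢ) ≥ i − 1 }`; equivalently, the largest `i` such
that at least `i` vertices have acyclic degree at least `i − 1`. -/
noncomputable def maDeg [Fintype V] (G : SimpleGraph V) : ℕ :=
  sSup { i | i ≤ {v : V | i - 1 ≤ aDeg G v}.ncard }

/-- A coloring is acyclic iff it is proper and no cycle uses at most two colors. -/
theorem isAcyclicColoring_iff {G : SimpleGraph V} {c : V → ℕ} :
    IsAcyclicColoring G c ↔ Proper G c ∧ ∀ (i j : ℕ) (v : V) (p : G.Walk v v),
      p.IsCycle → ∃ u ∈ p.support, ¬ (c u = i ∨ c u = j) := by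
  refine and_congr_right fun _ => forall₂_congr fun i j => ⟨fun h v p hp => ?_, fun h v p hp => ?_⟩
  · by_contra! hc
    have hs : ∀ u ∈ p.support, u ∈ {v | c v = i ∨ c v = j} := hc
    refine h (p.induce _ hs) ?_
    rw [← Walk.isCycle_map_iff_of_injective (f := (Embedding.induce _).toHom)
      (Embedding.induce (G := G) {v | c v = i ∨ c v = j}).injective, Walk.map_induce]
    exact hp
  · obtain ⟨u, hu, hc⟩ := h _ (p.map (Embedding.induce _).toHom)
      (hp.map (Embedding.induce (G := G) {v | c v = i ∨ c v = j}).injective)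
    rw [Walk.support_map, List.mem_map] at hu
    obtain ⟨w, _, rfl⟩ := hu
    exact hc w.2

/-- Along a walk colored properly with two colors `l` and `j` and starting in `l`, the vertices
are colored `l` and `j` alternately. -/
theorem color_getVert_of_two_colors {G : SimpleGraph V} {c : V → ℕ} (hc : Proper G c) {l j : ℕ}
    {x w : V} (p : G.Walk x w) (hx : c x = l) (hp : ∀ u ∈ p.support, c u = l ∨ c u = j)
    (n : ℕ) (hn : n ≤ p.length) : c (p.getVert n) = if Even n then l else j := by
  induction n with
  | zero => simpa using hx
  | succ n ih =>
    have h1 := ih (by lia)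
    have h2 := hc (p.adj_getVert_succ (i := n) (by lia))
    have h3 := hp _ (p.getVert_mem_support (n + 1))
    have h4 := hp _ (p.getVert_mem_support n)
    by_cases he : Even n <;> simp [he, Nat.even_add_one] at h1 ⊢ <;> grind

/-- If recoloring `v` with a color `j` absent from its neighborhood destroys acyclicity, then two
neighbors of `v` of the same color are joined by a path of even length that avoids `v` and has
color `j` at all even positions. -/
theorem exists_path_of_not_isAcyclicColoring_update [DecidableEq V] {G : SimpleGraph V}
    {c : V → ℕ} (hc : IsAcyclicColoring G c) {v : V} {j : ℕ} (hj : ∀ u, G.Adj v u → c u ≠ j)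
    (h : ¬ IsAcyclicColoring G (Function.update c v j)) :
    ∃ (x w : V) (p : G.Walk x w), p.IsPath ∧ Even p.length ∧ x ≠ w ∧ v ∉ p.support ∧
      G.Adj v x ∧ G.Adj v w ∧ c x = c w ∧ ∀ y ∈ evenVerts p, c y = j := by
  rw [isAcyclicColoring_iff] at hc h
  obtain ⟨hprop, hcyc⟩ := hc
  have hprop' : Proper G (Function.update c v j) := by
    intro a b hab
    have := hprop hab
    have h1 := hab.ne
    by_cases ha : a = v
    · subst ha
      simpa [h1.symm] using (hj b hab).symm
    · by_cases hb : b = v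
      · subst hb
        simpa [h1] using hj a hab.symm
      · simpa [ha, hb] using this
  have hne : ∀ u, u ≠ v → Function.update c v j u = c u := fun u hu => by simp [hu]
  have hnbr : ∀ u, G.Adj v u → Function.update c v j u = c u := fun u hu => hne u hu.ne'
  simp only [hprop', true_and] at h
  push Not at h
  obtain ⟨a, b, z, p, hp, hab⟩ := h
  have hv : v ∈ p.support := by
    by_contra hv
    obtain ⟨u, hu, hu'⟩ := hcyc a b z p hp
    have := hab u hu
    rw [hne u (by rintro rfl; exact hv hu)] at this
    exact hu' this
  obtain ⟨q, hq, hqs⟩ : ∃ q : G.Walk v v, q.IsCycle ∧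
      ∀ u ∈ q.support, Function.update c v j u = a ∨ Function.update c v j u = b :=
    ⟨p.rotate v hv, hp.rotate hv, fun u hu => hab u ((Walk.mem_support_rotate_iff ..).1 hu)⟩
  obtain ⟨l, hl⟩ : ∃ l, ∀ u ∈ q.support, Function.update c v j u = l ∨
      Function.update c v j u = j := by
    have := hqs v q.start_mem_support
    simp only [Function.update_self] at this
    rcases this with rfl | rfl
    · exact ⟨b, fun u hu => (hqs u hu).symm⟩
    · exact ⟨a, hqs⟩
  clear hqs
  cases q with
  | nil => exact absurd hq Walk.not_isCycle_nil
  | @cons _ x _ hvx q =>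
    rw [Walk.cons_isCycle_iff] at hq
    obtain ⟨hq1, hq2⟩ := hq
    obtain ⟨r, rfl⟩ : ∃ r : G.Walk v x, q = r.reverse := ⟨q.reverse, by simp⟩
    cases r with
    | nil => exact absurd hvx (G.loopless.irrefl _)
    | @cons _ w _ hvw r =>
      rw [Walk.isPath_reverse_iff, Walk.cons_isPath_iff] at hq1
      have hr : ∀ u ∈ r.reverse.support, c u = l ∨ c u = j := by
        intro u hu
        have huv : u ≠ v := by
          rintro rfl
          exact hq1.2 (by simpa using hu)
        rw [← hne u huv]
        refine hl u ?_
        simp at hu ⊢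
        tauto
      have hx : c x = l := (hr x (by simp)).resolve_right (hj x hvx)
      have hw : c w = l := (hr w (by simp)).resolve_right (hj w hvw)
      have halt := color_getVert_of_two_colors hprop r.reverse hx hr
      refine ⟨x, w, r.reverse, by simpa using hq1.1, ?_, ?_, by simpa using hq1.2, hvx, hvw,
        hx.trans hw.symm, ?_⟩
      · by_contra he
        have := halt _ le_rfl
        rw [if_neg he, Walk.getVert_length] at this
        exact hj w hvw this
      · rintro rfl
        simp at hq2
      · rintro y ⟨t, ht, rfl⟩
        rw [halt _ ht.le, if_neg (by simp)]

theorem elp_bddAbove [Fintype V] (G : SimpleGraph V) (v : V) (P : WeakPartition G v) :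
    ∀ m, (∃ F : Fin m → Σ u : V, Σ w : V, G.Walk u w,
      (∀ a, QualPath G v P (F a).2.2) ∧
      (∀ a b, a ≠ b → Disjoint (evenVerts (F a).2.2) (evenVerts (F b).2.2))) →
      m ≤ Fintype.card V := by
  rintro m ⟨F, hF, hd⟩
  have hmem : ∀ a, (F a).2.2.getVert 1 ∈ evenVerts (F a).2.2 := by
    intro a
    obtain ⟨-, ⟨n, hn⟩, h0, -⟩ := hF a
    exact ⟨0, by lia, rfl⟩
  have hinj : Function.Injective fun a => (F a).2.2.getVert 1 := by
    intro a b hab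
    by_contra hne
    refine Set.disjoint_left.1 (hd a b hne) (hmem a) ?_
    dsimp only at hab
    rw [hab]
    exact hmem b
  simpa using Fintype.card_le_of_injective _ hinj

theorem WeakPartition.k_le_card [Fintype V] {G : SimpleGraph V} {v : V} (P : WeakPartition G v) :
    P.k ≤ Fintype.card V := by
  have hne : ∀ i : Fin P.k, ∃ u, u ∈ P.A i.succ := fun i =>
    Finset.card_pos.1 (by have := P.two_le i.succ (Fin.succ_ne_zero i); lia)
  choose f hf using hne
  have hinj : Function.Injective f := by
    intro a b hab
    by_contra hne
    refine Finset.disjoint_left.1 (P.pairwiseDisjoint a.succ b.succ (by simpa using hne)) (hf a) ?_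
    rw [hab]
    exact hf b
  simpa using Fintype.card_le_of_injective f hinj

theorem le_aDeg [Fintype V] {G : SimpleGraph V} {v : V} (P : WeakPartition G v) {m : ℕ}
    (F : Fin m → Σ u : V, Σ w : V, G.Walk u w) (hF : ∀ a, QualPath G v P (F a).2.2)
    (hd : ∀ a b, a ≠ b → Disjoint (evenVerts (F a).2.2) (evenVerts (F b).2.2)) :
    (P.A 0).card + P.k + m ≤ aDeg G v := by
  have h1 : m ≤ elp G v P := le_csSup ⟨_, elp_bddAbove G v P⟩ ⟨F, hF, hd⟩
  refine (Nat.add_le_add_left h1 _).trans (le_csSup ⟨3 * Fintype.card V, ?_⟩ ⟨P, rfl⟩)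
  rintro _ ⟨Q, rfl⟩
  have h2 : elp G v Q ≤ Fintype.card V := csSup_le' (elp_bddAbove G v Q)
  have h3 := (Q.A 0).card_le_univ
  have h4 := Q.k_le_card
  lia

/-- The weak partition of `N(v)` by color: `A₀` collects the neighbors whose color is unique in
`N(v)`, and the other parts are the color classes of `N(v)` with at least two vertices. -/
theorem exists_weakPartition_of_coloring [Fintype V] (G : SimpleGraph V) (c : V → ℕ) (v : V) :
    ∃ P : WeakPartition G v,
      (c '' G.neighborSet v).ncard ≤ (P.A 0).card + P.k ∧
      ∀ x w, G.Adj v x → G.Adj v w → x ≠ w → c x = c w →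
        ∃ i : Fin (P.k + 1), i ≠ 0 ∧ x ∈ P.A i ∧ w ∈ P.A i := by
  classical
  let N : Finset V := G.neighborFinset v
  let T : Finset ℕ := (N.image c).filter fun a => 2 ≤ (N.filter fun u => c u = a).card
  let e : Fin T.card ≃ T := T.equivFin.symm
  let A : Fin (T.card + 1) → Finset V :=
    Fin.cons (N.filter fun u => c u ∉ T) fun i => N.filter fun u => c u = e i
  have hA0 : ∀ u, u ∈ A 0 ↔ G.Adj v u ∧ c u ∉ T := by simp [A, N]
  have hA1 : ∀ i u, u ∈ A (Fin.succ i) ↔ G.Adj v u ∧ c u = e i := by simp [A, N]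
  have heT : ∀ a ∈ T, ∃ i, (e i : ℕ) = a := fun a ha => ⟨e.symm ⟨a, ha⟩, by simp⟩
  refine ⟨⟨T.card, A, ?_, ?_, ?_⟩, ?_, ?_⟩
  · intro i j hij
    rw [Finset.disjoint_left]
    intro u hi hj
    induction i using Fin.cases with
    | zero =>
      induction j using Fin.cases with
      | zero => exact hij rfl
      | succ j => exact ((hA0 u).1 hi).2 (((hA1 j u).1 hj).2 ▸ (e j).2)
    | succ i =>
      induction j using Fin.cases with
      | zero => exact ((hA0 u).1 hj).2 (((hA1 i u).1 hi).2 ▸ (e i).2)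
      | succ j =>
        refine hij (congrArg Fin.succ (e.injective (Subtype.ext ?_)))
        rw [← ((hA1 i u).1 hi).2, ← ((hA1 j u).1 hj).2]
  · intro u
    rw [mem_neighborSet]
    constructor
    · intro hu
      by_cases hT : c u ∈ T
      · obtain ⟨i, hi⟩ := heT _ hT
        exact ⟨i.succ, (hA1 i u).2 ⟨hu, hi.symm⟩⟩
      · exact ⟨0, (hA0 u).2 ⟨hu, hT⟩⟩
    · rintro ⟨i, hi⟩
      induction i using Fin.cases with
      | zero => exact ((hA0 u).1 hi).1
      | succ i => exact ((hA1 i u).1 hi).1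
  · intro i hi
    induction i using Fin.cases with
    | zero => exact absurd rfl hi
    | succ i => exact (Finset.mem_filter.1 (e i).2).2
  · have hsub : c '' G.neighborSet v ⊆ (((A 0).image c ∪ T : Finset ℕ) : Set ℕ) := by
      rintro _ ⟨u, hu, rfl⟩
      by_cases hT : c u ∈ T
      · simp [hT]
      · have : u ∈ A 0 := (hA0 u).2 ⟨hu, hT⟩
        simp only [Finset.coe_union, Finset.coe_image]
        exact Or.inl ⟨u, this, rfl⟩
    refine (Set.ncard_le_ncard hsub (Finset.finite_toSet _)).trans ?_
    rw [Set.ncard_coe_finset]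
    exact (Finset.card_union_le _ _).trans (Nat.add_le_add_right Finset.card_image_le _)
  · intro x w hx hw hne hxw
    have hT : c x ∈ T := by
      refine Finset.mem_filter.2 ⟨Finset.mem_image.2 ⟨x, by simpa [N] using hx, rfl⟩, ?_⟩
      refine Finset.one_lt_card.2 ⟨x, ?_, w, ?_, hne⟩
      · simpa [N] using hx
      · simpa [N, hxw] using hw
    obtain ⟨i, hi⟩ := heT _ hT
    exact ⟨i.succ, Fin.succ_ne_zero i, (hA1 i x).2 ⟨hx, hi.symm⟩,
      (hA1 i w).2 ⟨hw, by rw [hi, hxw]⟩⟩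

/-- If `v` has acyclic degree less than `|S|`, then some color of `S` is absent from the
neighborhood of `v` and can be given to `v` without destroying acyclicity. -/
theorem exists_isAcyclicColoring_update [Fintype V] [DecidableEq V] {G : SimpleGraph V}
    {c : V → ℕ} (hc : IsAcyclicColoring G c) {v : V} {S : Finset ℕ} (hS : aDeg G v < S.card) :
    ∃ j ∈ S, (∀ u, G.Adj v u → c u ≠ j) ∧ IsAcyclicColoring G (Function.update c v j) := by
  classical
  by_contra! hbad
  obtain ⟨P, hP, hPpair⟩ := exists_weakPartition_of_coloring G c v
  let B : Finset ℕ := S.filter fun j => ∀ u, G.Adj v u → c u ≠ j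
  have hpath : ∀ j : B, ∃ F : Σ u : V, Σ w : V, G.Walk u w,
      QualPath G v P F.2.2 ∧ ∀ y ∈ evenVerts F.2.2, c y = j := by
    rintro ⟨j, hj⟩
    obtain ⟨hjS, hjN⟩ := Finset.mem_filter.1 hj
    obtain ⟨x, w, p, hp, he, hne, hv, hvx, hvw, hxw, hcol⟩ :=
      exists_path_of_not_isAcyclicColoring_update hc hjN (hbad j hjS hjN)
    refine ⟨⟨x, w, p⟩, ⟨hp, he, ?_, hv, hPpair x w hvx hvw hne hxw⟩, hcol⟩
    exact Nat.pos_of_ne_zero fun h0 => hne (Walk.eq_of_length_eq_zero h0)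
  choose F hF hFcol using hpath
  have hdeg := le_aDeg P (fun a => F (B.equivFin.symm a)) (fun a => hF _) fun a b hab => by
    rw [Set.disjoint_left]
    intro y ha hb
    refine hab (B.equivFin.symm.injective (Subtype.ext ?_))
    rw [← hFcol _ y ha, ← hFcol _ y hb]
  have hcover : (S : Set ℕ) ⊆ c '' G.neighborSet v ∪ B := by
    intro j hj
    by_cases h : ∀ u, G.Adj v u → c u ≠ j
    · exact Or.inr (Finset.mem_coe.2 (Finset.mem_filter.2 ⟨hj, h⟩))
    · push Not at h
      obtain ⟨u, hu, rfl⟩ := h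
      exact Or.inl ⟨u, hu, rfl⟩
  have h1 := Set.ncard_le_ncard hcover ((Set.toFinite _).union (Finset.finite_toSet _))
  have h2 := Set.ncard_union_le (c '' G.neighborSet v) (B : Set ℕ)
  rw [Set.ncard_coe_finset] at h1 h2
  lia

/-- A set of vertices of color `i` whose acyclic degrees are less than `|S|` can be recolored with
colors of `S`. -/
theorem exists_recoloring [Fintype V] [DecidableEq V] {G : SimpleGraph V} {c : V → ℕ}
    (hc : IsAcyclicColoring G c) {i : ℕ} {S : Finset ℕ} (R : Finset V)
    (hR : ∀ v ∈ R, c v = i ∧ aDeg G v < S.card) :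
    ∃ c', IsAcyclicColoring G c' ∧ (∀ v ∉ R, c' v = c v) ∧
      ∀ v ∈ R, c' v ∈ S ∧ ∀ u, G.Adj v u → c u ≠ c' v := by
  induction R using Finset.induction_on with
  | empty => exact ⟨c, hc, by simp, by simp⟩
  | insert v R hv ih =>
    obtain ⟨c', hc', hout, hin⟩ := ih fun u hu => hR u (Finset.mem_insert_of_mem hu)
    obtain ⟨hvi, hdeg⟩ := hR v (Finset.mem_insert_self v R)
    obtain ⟨j, hjS, hjN, hj⟩ := exists_isAcyclicColoring_update hc' hdeg
    refine ⟨_, hj, fun u hu => ?_, fun u hu => ?_⟩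
    · rw [Finset.mem_insert, not_or] at hu
      rw [Function.update_of_ne hu.1, hout u hu.2]
    · by_cases huv : u = v
      · subst huv
        rw [Function.update_self]
        refine ⟨hjS, fun w hw => ?_⟩
        have hwR : w ∉ R := fun h =>
          hc.1 hw (hvi.trans (hR w (Finset.mem_insert_of_mem h)).1.symm)
        rw [← hout w hwR]
        exact hjN w hw
      · rw [Function.update_of_ne huv]
        exact hin u ((Finset.mem_insert.1 hu).resolve_left huv)

/-- Every color class of a minimal acyclic coloring contains a vertex whose acyclic degree is at
least the number of colors minus one. -/
theorem IsMinimal.exists_le_aDeg [Fintype V] {G : SimpleGraph V} {c : V → ℕ}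
    (hc : IsMinimal G c) {i : ℕ} (hi : i ∈ Finset.univ.image c) :
    ∃ v, c v = i ∧ ncolors c - 1 ≤ aDeg G v := by
  classical
  by_contra! h
  obtain ⟨c', hc', hout, hin⟩ := exists_recoloring (i := i) (S := (Finset.univ.image c).erase i)
    hc.1 (Finset.univ.filter fun v => c v = i) fun v hv => by
      have hv := (Finset.mem_filter.1 hv).2
      rw [Finset.card_erase_of_mem hi]
      exact ⟨hv, h v hv⟩
  refine hc.2 c' ⟨hc.1, hc', i, by simpa using hi, fun v hv => hout v (by simpa using hv),
    fun v hv => ?_⟩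
  obtain ⟨hS, hN⟩ := hin v (by simpa using hv)
  rw [Finset.mem_erase] at hS
  refine ⟨by simpa using hS.2, hS.1, ?_⟩
  rintro u (rfl | hu)
  · exact hv ▸ hS.1.symm
  · exact hN u hu

/-- For every finite simple graph `G`, `A_b(G) ≤ m_a(G)`. -/
theorem ab_le_maDeg [Fintype V] (G : SimpleGraph V) : Ab G ≤ maDeg G := by
  refine csSup_le' ?_
  rintro _ ⟨c, hc, rfl⟩
  refine le_csSup ⟨Fintype.card V, fun i hi => ?_⟩ ?_
  · have h : {v : V | i - 1 ≤ aDeg G v}.ncard ≤ Nat.card V := Set.ncard_le_card _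
    rw [Nat.card_eq_fintype_card] at h
    exact le_trans hi h
  · have hsub : ((Finset.univ.image c : Finset ℕ) : Set ℕ) ⊆
        c '' {v : V | ncolors c - 1 ≤ aDeg G v} := by
      intro i hi
      obtain ⟨v, hv, hd⟩ := hc.exists_le_aDeg hi
      exact ⟨v, hd, hv⟩
    have h1 := Set.ncard_le_ncard hsub (Set.toFinite _)
    rw [Set.ncard_coe_finset] at h1
    exact h1.trans (Set.ncard_image_le (Set.toFinite _))

end AcyclicB
end

section
/- If G and H are finite simple graphs neither of which is complete, then the join satisfies A_b(G ∨ H) = max{ A_b(G) + |V(H)|, A_b(H) + |V(G)| }. -/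
open SimpleGraph

namespace AcyclicB

/-- A graph in which every edge has an endpoint of degree one is a forest. -/
theorem isAcyclic_of_forall_adj_leaf (G : SimpleGraph V)
    (h : ∀ u v, G.Adj u v → (∀ w, G.Adj u w → w = v) ∨ (∀ w, G.Adj v w → w = u)) :
    G.IsAcyclic := by
  have key : ∀ u v, G.Adj u v → (∀ w, G.Adj u w → w = v) →
      ¬ (G.deleteEdges {s(u, v)}).Reachable u v := by
    rintro u v huv hu ⟨p⟩
    cases p with
    | nil => exact G.irrefl huv
    | cons hadj q =>
      rw [SimpleGraph.deleteEdges_adj] at hadj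
      obtain rfl := hu _ hadj.1
      exact hadj.2 rfl
  rw [SimpleGraph.isAcyclic_iff_forall_adj_isBridge]
  intro u v huv
  rw [SimpleGraph.isBridge_iff]
  rcases h u v huv with h | h
  · exact key u v huv h
  · intro hr
    refine key v u huv.symm h ?_
    rw [Sym2.eq_swap]
    exact hr.symm

/-- Two color classes of a proper coloring induce a forest when one of them has at most one
vertex. -/
theorem Proper.isAcyclic_induce_of_subsingleton {G : SimpleGraph V} {c : V → ℕ}
    (hc : Proper G c) {i j : ℕ}
    (h : i = j ∨ (∀ u v, c u = i → c v = i → u = v) ∨ (∀ u v, c u = j → c v = j → u = v)) :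
    (G.induce {v | c v = i ∨ c v = j}).IsAcyclic := by
  apply isAcyclic_of_forall_adj_leaf
  rintro ⟨u, hu⟩ ⟨v, hv⟩ huv
  simp only [SimpleGraph.comap_adj, Function.Embedding.subtype_apply, Set.mem_ofPred_eq,
    Subtype.forall, Subtype.mk.injEq] at hu hv huv ⊢
  have huv' := hc huv
  rcases h with rfl | h | h
  · omega
  · by_cases hui : c u = i
    · exact Or.inr fun w hw hvw => h _ _ (by have := hc hvw; omega) hui
    · exact Or.inl fun w hw hvw => h _ _ (by have := hc hvw; omega) (by omega)
  · by_cases huj : c u = j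
    · exact Or.inr fun w hw hvw => h _ _ (by have := hc hvw; omega) huj
    · exact Or.inl fun w hw hvw => h _ _ (by have := hc hvw; omega) (by omega)

theorem isAcyclicColoring_of_injective (G : SimpleGraph V) {c : V → ℕ}
    (hc : Function.Injective c) : IsAcyclicColoring G c := by
  have hp : Proper G c := fun u v huv h => huv.ne (hc h)
  exact ⟨hp, fun i j => hp.isAcyclic_induce_of_subsingleton
    (Or.inr (Or.inl fun u v hu hv => hc (hu.trans hv.symm)))⟩

/-- Acyclic colorings pull back along graph embeddings. -/
theorem IsAcyclicColoring.comap {W : Type*} {G : SimpleGraph V} {G' : SimpleGraph W}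
    (e : G ↪g G') {c : W → ℕ} (hc : IsAcyclicColoring G' c) :
    IsAcyclicColoring G (c ∘ e) := by
  refine ⟨fun u v huv => hc.1 (e.map_rel_iff.2 huv), fun i j => ?_⟩
  let f : G.induce {v | (c ∘ e) v = i ∨ (c ∘ e) v = j} →g G'.induce {v | c v = i ∨ c v = j} :=
    { toFun := fun v => ⟨e v.1, v.2⟩
      map_rel' := fun {a b} hab => e.map_rel_iff.2 hab }
  refine (hc.2 i j).comap f fun a b hab => ?_
  exact Subtype.ext (e.injective (congrArg Subtype.val hab))

/-- Recoloring steps are invariant under graph isomorphism. -/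
theorem RecolorStep.comap {W : Type*} {G : SimpleGraph V} {G' : SimpleGraph W}
    (e : G ≃g G') {c' c : W → ℕ} (h : RecolorStep G' c' c) :
    RecolorStep G (c' ∘ e) (c ∘ e) := by
  obtain ⟨hc, hc', i, hi, h1, h2⟩ := h
  have hr : Set.range (c ∘ e) = Set.range c := e.surjective.range_comp c
  refine ⟨hc.comap e.toEmbedding, hc'.comap e.toEmbedding, i, hr ▸ hi,
    fun v hv => h1 _ hv, fun v hv => ?_⟩
  obtain ⟨h3, h4, h5⟩ := h2 _ hv
  refine ⟨hr ▸ h3, h4, fun u hu => h5 _ ?_⟩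
  rcases hu with rfl | hu
  · exact Set.mem_insert _ _
  · exact Set.mem_insert_of_mem _ (e.map_rel_iff.2 hu)

theorem IsMinimal.comap {W : Type*} {G : SimpleGraph V} {G' : SimpleGraph W}
    (e : G ≃g G') {c : W → ℕ} (h : IsMinimal G' c) : IsMinimal G (c ∘ e) := by
  refine ⟨h.1.comap e.toEmbedding, fun c' hc' => h.2 (c' ∘ e.symm) ?_⟩
  have := hc'.comap e.symm
  rwa [Function.comp_assoc, show (e ∘ e.symm : W → W) = id from funext e.apply_symm_apply] at this

theorem exists_injective_ge (V : Type*) [Finite V] (N : ℕ) :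
    ∃ c : V → ℕ, Function.Injective c ∧ ∀ v, N ≤ c v := by
  obtain ⟨n, ⟨e⟩⟩ := Finite.exists_equiv_fin V
  exact ⟨fun v => N + e v, fun u v huv => e.injective (Fin.ext (Nat.add_left_cancel huv)),
    fun v => Nat.le_add_right _ _⟩

theorem exists_isMinimal [Fintype V] (G : SimpleGraph V) : ∃ c, IsMinimal G c := by
  obtain ⟨c₀, hc₀, -⟩ := exists_injective_ge V 0
  have hne : {c | IsAcyclicColoring G c}.Nonempty := ⟨c₀, isAcyclicColoring_of_injective G hc₀⟩
  refine ⟨Function.argminOn ncolors _ hne, Function.argminOn_mem ncolors _ hne, fun c' hc' => ?_⟩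
  exact Function.not_lt_argminOn ncolors _ hc'.2.1 hc'.ncolors_lt

theorem isGreatest_Ab [Fintype V] (G : SimpleGraph V) :
    IsGreatest {k | ∃ c : V → ℕ, IsMinimal G c ∧ ncolors c = k} (Ab G) := by
  have hb : BddAbove {k | ∃ c : V → ℕ, IsMinimal G c ∧ ncolors c = k} := by
    refine ⟨Fintype.card V, ?_⟩
    rintro _ ⟨c, -, rfl⟩
    exact Finset.card_image_le
  obtain ⟨c, hc⟩ := exists_isMinimal G
  exact ⟨Nat.sSup_mem ⟨_, c, hc, rfl⟩ hb, fun k hk => le_csSup hb hk⟩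

/-- An injective coloring of a non-complete graph is not minimal. -/
theorem IsMinimal.not_injective {G : SimpleGraph V} (hG : G ≠ ⊤) {c : V → ℕ}
    (hc : IsMinimal G c) : ¬ Function.Injective c := by
  classical
  intro hinj
  obtain ⟨u, v, huv, hadj⟩ : ∃ u v, u ≠ v ∧ ¬ G.Adj u v := by
    by_contra! h
    exact hG (top_unique fun u v huv => h u v huv)
  have hcuv : c v ≠ c u := fun h => huv (hinj h).symm
  have hval : ∀ x y, Function.update c u (c v) x = Function.update c u (c v) y →
      x = y ∨ x = u ∧ y = v ∨ x = v ∧ y = u := by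
    intro x y hxy
    by_cases hx : x = u <;> by_cases hy : y = u
    · exact Or.inl (hx.trans hy.symm)
    · subst hx
      rw [Function.update_self, Function.update_of_ne hy] at hxy
      exact Or.inr (Or.inl ⟨rfl, (hinj hxy).symm⟩)
    · subst hy
      rw [Function.update_self, Function.update_of_ne hx] at hxy
      exact Or.inr (Or.inr ⟨hinj hxy, rfl⟩)
    · rw [Function.update_of_ne hx, Function.update_of_ne hy] at hxy
      exact Or.inl (hinj hxy)
  have hp : Proper G (Function.update c u (c v)) := by
    intro x y hadj' hxy
    rcases hval x y hxy with rfl | ⟨rfl, rfl⟩ | ⟨rfl, rfl⟩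
    · exact G.irrefl hadj'
    · exact hadj hadj'
    · exact hadj hadj'.symm
  have hsub : ∀ k, k ≠ c v → ∀ x y, Function.update c u (c v) x = k →
      Function.update c u (c v) y = k → x = y := by
    intro k hk x y hx hy
    rcases hval x y (hx.trans hy.symm) with h | ⟨rfl, rfl⟩ | ⟨rfl, rfl⟩
    · exact h
    · rw [Function.update_self] at hx
      exact absurd hx.symm hk
    · rw [Function.update_self] at hy
      exact absurd hy.symm hk
  refine hc.2 (Function.update c u (c v)) ⟨hc.1, ⟨hp, fun i j => ?_⟩, c u, ⟨u, rfl⟩, ?_, ?_⟩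
  · apply hp.isAcyclic_induce_of_subsingleton
    by_cases hi : i = c v
    · by_cases hj : j = c v
      · exact Or.inl (hi.trans hj.symm)
      · exact Or.inr (Or.inr (hsub j hj))
    · exact Or.inr (Or.inl (hsub i hi))
  · intro w hw
    exact Function.update_of_ne (fun h => hw (congrArg c h)) _ _
  · intro w hw
    obtain rfl := hinj hw
    rw [Function.update_self]
    refine ⟨⟨v, rfl⟩, hcuv, fun x hx hxv => ?_⟩
    obtain rfl := hinj hxv
    rcases hx with h | h
    · exact huv h.symm
    · exact hadj h

section Join

variable {α β : Type*} {G : SimpleGraph α} {H : SimpleGraph β}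

/-- The left embedding of a graph into a join. -/
def joinInl (G : SimpleGraph α) (H : SimpleGraph β) : G ↪g join G H where
  toFun := Sum.inl
  inj' := Sum.inl_injective
  map_rel_iff' := Iff.rfl

/-- The right embedding of a graph into a join. -/
def joinInr (G : SimpleGraph α) (H : SimpleGraph β) : H ↪g join G H where
  toFun := Sum.inr
  inj' := Sum.inr_injective
  map_rel_iff' := Iff.rfl

/-- The join is commutative up to isomorphism. -/
def joinComm (G : SimpleGraph α) (H : SimpleGraph β) : join G H ≃g join H G where
  toEquiv := Equiv.sumComm α β
  map_rel_iff' := by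
    rintro (a | b) (a' | b') <;> exact Iff.rfl

theorem Proper.join_ne {c : α ⊕ β → ℕ} (hc : Proper (join G H) c) (a : α) (b : β) :
    c (Sum.inl a) ≠ c (Sum.inr b) :=
  hc (show (join G H).Adj (Sum.inl a) (Sum.inr b) from trivial)

/-- An acyclic coloring of a join is injective on one of the two sides. -/
theorem IsAcyclicColoring.injective_or_injective {c : α ⊕ β → ℕ}
    (hc : IsAcyclicColoring (join G H) c) :
    Function.Injective (c ∘ Sum.inl) ∨ Function.Injective (c ∘ Sum.inr) := by
  by_contra! h
  obtain ⟨h₁, h₂⟩ := h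
  simp only [Function.Injective, not_forall, Function.comp_apply] at h₁ h₂
  obtain ⟨a, a', haa, hne⟩ := h₁
  obtain ⟨b, b', hbb, hne'⟩ := h₂
  have hac := hc.2 (c (Sum.inl a)) (c (Sum.inr b))
  set K := (join G H).induce
    {v | c v = c (Sum.inl a) ∨ c v = c (Sum.inr b)}
  let x : {v | c v = c (Sum.inl a) ∨ c v = c (Sum.inr b)} := ⟨Sum.inl a, Or.inl rfl⟩
  let x' : {v | c v = c (Sum.inl a) ∨ c v = c (Sum.inr b)} := ⟨Sum.inl a', Or.inl haa.symm⟩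
  let y : {v | c v = c (Sum.inl a) ∨ c v = c (Sum.inr b)} := ⟨Sum.inr b, Or.inr rfl⟩
  let y' : {v | c v = c (Sum.inl a) ∨ c v = c (Sum.inr b)} := ⟨Sum.inr b', Or.inr hbb.symm⟩
  have hxy : K.Adj x y := trivial
  have hyx : K.Adj y x' := trivial
  have hxy' : K.Adj x y' := trivial
  have hyx' : K.Adj y' x' := trivial
  have hxx : x ≠ x' := fun h => hne (Sum.inl_injective (congrArg Subtype.val h))
  have hyy : y ≠ y' := fun h => hne' (Sum.inr_injective (congrArg Subtype.val h))
  have hp : (Walk.cons hxy (Walk.cons hyx Walk.nil)).IsPath := by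
    simp [hxy.ne, hyx.ne, hxx]
  have hp' : (Walk.cons hxy' (Walk.cons hyx' Walk.nil)).IsPath := by
    simp [hxy'.ne, hyx'.ne, hxx]
  have := congrArg (fun p : K.Path x x' => p.1.support)
    ((hac.subsingleton_path x x').elim ⟨_, hp⟩ ⟨_, hp'⟩)
  simp only [Walk.support_cons, Walk.support_nil, List.cons.injEq, and_true, true_and] at this
  exact hyy this

/-- An acyclic coloring of `G` and an injective coloring of `H` with disjoint colors combine to
an acyclic coloring of the join. -/
theorem isAcyclicColoring_join {c : α ⊕ β → ℕ} (hG : IsAcyclicColoring G (c ∘ Sum.inl))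
    (hH : Function.Injective (c ∘ Sum.inr)) (hd : ∀ a b, c (Sum.inl a) ≠ c (Sum.inr b)) :
    IsAcyclicColoring (join G H) c := by
  have hp : Proper (join G H) c := by
    rintro (a | b) (a' | b') h
    · exact hG.1 h
    · exact hd a b'
    · exact (hd a' b).symm
    · exact fun h' => H.ne_of_adj h (hH h')
  have hsub : ∀ b x y, c x = c (Sum.inr b) → c y = c (Sum.inr b) → x = y := by
    have : ∀ b x, c x = c (Sum.inr b) → x = Sum.inr b := by
      rintro b (a | b') h
      · exact absurd h (hd a b)
      · exact congrArg Sum.inr (hH h)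
    exact fun b x y hx hy => (this b x hx).trans (this b y hy).symm
  refine ⟨hp, fun i j => ?_⟩
  by_cases hi : ∃ b, c (Sum.inr b) = i
  · obtain ⟨b, rfl⟩ := hi
    exact hp.isAcyclic_induce_of_subsingleton (Or.inr (Or.inl (hsub b)))
  by_cases hj : ∃ b, c (Sum.inr b) = j
  · obtain ⟨b, rfl⟩ := hj
    exact hp.isAcyclic_induce_of_subsingleton (Or.inr (Or.inr (hsub b)))
  have hl : ∀ v : {v | c v = i ∨ c v = j}, ∃ a, v.1 = Sum.inl a := by
    rintro ⟨a | b, hv⟩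
    · exact ⟨a, rfl⟩
    · exact absurd hv (not_or.2 ⟨fun h => hi ⟨b, h⟩, fun h => hj ⟨b, h⟩⟩)
  choose g hg using hl
  let f : (join G H).induce {v | c v = i ∨ c v = j} →g
      G.induce {v | (c ∘ Sum.inl) v = i ∨ (c ∘ Sum.inl) v = j} :=
    { toFun := fun v => ⟨g v, by
        have := v.2
        rw [hg v] at this
        exact this⟩
      map_rel' := fun {x y} hxy => by
        have hxy' : (join G H).Adj x.1 y.1 := hxy
        rw [hg x, hg y] at hxy'
        exact hxy' }
  refine (hG.2 i j).comap f fun x y hxy => Subtype.ext ?_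
  rw [hg x, hg y]
  exact congrArg Sum.inl (congrArg Subtype.val hxy)

theorem IsMinimal.of_join {c : α ⊕ β → ℕ} (hc : IsMinimal (join G H) c)
    (hH : Function.Injective (c ∘ Sum.inr)) : IsMinimal G (c ∘ Sum.inl) := by
  have hd := hc.1.1.join_ne
  refine ⟨hc.1.comap (joinInl G H), fun f' hf' => ?_⟩
  obtain ⟨-, hf, i, ⟨a₀, rfl⟩, h1, h2⟩ := hf'
  have hrange : ∀ a, f' a ∈ Set.range (c ∘ Sum.inl) := fun a => by
    by_cases ha : c (Sum.inl a) = c (Sum.inl a₀)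
    · exact (h2 a ha).1
    · exact ⟨a, (h1 a ha).symm⟩
  have hd' : ∀ a b, f' a ≠ c (Sum.inr b) := fun a b => by
    obtain ⟨a', ha'⟩ := hrange a
    exact ha' ▸ hd a' b
  refine hc.2 (Sum.elim f' (c ∘ Sum.inr))
    ⟨hc.1, isAcyclicColoring_join hf hH hd', c (Sum.inl a₀), ⟨_, rfl⟩, ?_, ?_⟩
  · rintro (a | b) hv
    · exact h1 a hv
    · rfl
  · rintro (a | b) hv
    · obtain ⟨-, h3, h4⟩ := h2 a hv
      obtain ⟨a', ha'⟩ := hrange a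
      refine ⟨⟨Sum.inl a', ha'⟩, h3, ?_⟩
      rintro (a'' | b) hu
      · apply h4
        rcases hu with hu | hu
        · exact Or.inl (Sum.inl_injective hu)
        · exact Or.inr hu
      · exact (hd' a b).symm
    · exact absurd hv.symm (hd a₀ b)

theorem isMinimal_join {c : α ⊕ β → ℕ} (hG : G ≠ ⊤) (hc : IsMinimal G (c ∘ Sum.inl))
    (hH : Function.Injective (c ∘ Sum.inr)) (hd : ∀ a b, c (Sum.inl a) ≠ c (Sum.inr b)) :
    IsMinimal (join G H) c := by
  refine ⟨isAcyclicColoring_join hc.1 hH hd, ?_⟩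
  rintro c' ⟨-, hc', i, ⟨w, rfl⟩, h1, h2⟩
  rcases w with a₀ | b₀
  · refine hc.2 (c' ∘ Sum.inl) ⟨hc.1, hc'.comap (joinInl G H), c (Sum.inl a₀), ⟨a₀, rfl⟩,
      fun a ha => h1 _ ha, fun a ha => ?_⟩
    obtain ⟨⟨w, hw⟩, h3, h4⟩ := h2 _ ha
    refine ⟨?_, h3, fun u hu => h4 _ ?_⟩
    · rcases w with a' | b
      · exact ⟨a', hw⟩
      · exact absurd hw (h4 (Sum.inr b) (Or.inr trivial))
    · rcases hu with rfl | hu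
      · exact Or.inl rfl
      · exact Or.inr hu
  · rcases hc'.injective_or_injective with h | h
    · apply hc.not_injective hG
      have : c ∘ Sum.inl = c' ∘ Sum.inl := funext fun a => (h1 _ (hd a b₀)).symm
      rwa [this]
    · obtain ⟨⟨w, hw⟩, h3, h4⟩ := h2 (Sum.inr b₀) rfl
      rcases w with a | b
      · exact h4 (Sum.inl a) (Or.inr trivial) hw
      · rw [← hw] at h3
        have hb : b = b₀ := h ((h1 _ h3).trans hw)
        exact h3 (hb ▸ rfl)

theorem ncolors_join [Fintype α] [Fintype β] {c : α ⊕ β → ℕ}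
    (hH : Function.Injective (c ∘ Sum.inr)) (hd : ∀ a b, c (Sum.inl a) ≠ c (Sum.inr b)) :
    ncolors c = ncolors (c ∘ Sum.inl) + Fintype.card β := by
  have h : Finset.univ.image c =
      Finset.univ.image (c ∘ Sum.inl) ∪ Finset.univ.image (c ∘ Sum.inr) := by
    ext x
    simp
  rw [ncolors, h, Finset.card_union_of_disjoint, Finset.card_image_of_injective _ hH,
    Finset.card_univ, ncolors]
  rw [Finset.disjoint_left]
  intro x hx hx'
  obtain ⟨a, -, rfl⟩ := Finset.mem_image.1 hx
  obtain ⟨b, -, hb⟩ := Finset.mem_image.1 hx'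
  exact hd a b hb.symm

theorem ncolors_comp_equiv {W : Type*} [Fintype V] [Fintype W] (e : V ≃ W) (c : W → ℕ) :
    ncolors (c ∘ e) = ncolors c := by
  classical
  rw [ncolors, ncolors, ← Finset.image_image, Finset.image_univ_equiv]

theorem Ab_le_of_iso {W : Type*} [Fintype V] [Fintype W] {G : SimpleGraph V} {G' : SimpleGraph W}
    (e : G ≃g G') : Ab G' ≤ Ab G := by
  obtain ⟨c, hc, hk⟩ := (isGreatest_Ab G').1
  exact (isGreatest_Ab G).2 ⟨_, hc.comap e, (ncolors_comp_equiv e.toEquiv c).trans hk⟩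

theorem Ab_add_card_le [Fintype α] [Fintype β] (hG : G ≠ ⊤) :
    Ab G + Fintype.card β ≤ Ab (join G H) := by
  obtain ⟨f, hf, hk⟩ := (isGreatest_Ab G).1
  obtain ⟨g, hg, hN⟩ := exists_injective_ge β (Finset.univ.sup f + 1)
  have hd : ∀ a b, Sum.elim f g (Sum.inl a) ≠ Sum.elim f g (Sum.inr b) := fun a b => by
    have h1 := Finset.le_sup (f := f) (Finset.mem_univ a)
    have h2 := hN b
    simp only [Sum.elim_inl, Sum.elim_inr]
    omega
  refine (isGreatest_Ab (join G H)).2 ⟨Sum.elim f g, isMinimal_join hG hf hg hd, ?_⟩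
  rw [ncolors_join (c := Sum.elim f g) hg hd, Sum.elim_comp_inl, hk]

theorem IsMinimal.ncolors_join_le [Fintype α] [Fintype β] {c : α ⊕ β → ℕ}
    (hc : IsMinimal (join G H) c) (hH : Function.Injective (c ∘ Sum.inr)) :
    ncolors c ≤ Ab G + Fintype.card β := by
  rw [ncolors_join hH hc.1.1.join_ne]
  exact Nat.add_le_add_right ((isGreatest_Ab G).2 ⟨_, hc.of_join hH, rfl⟩) _

end Join

/-- If `G` and `H` are finite simple graphs neither of which is complete, then
`A_b(G ∨ H) = max { A_b(G) + |V(H)|, A_b(H) + |V(G)| }`. -/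
theorem ab_join {α β : Type*} [Fintype α] [Fintype β]
    (G : SimpleGraph α) (H : SimpleGraph β) (hG : G ≠ ⊤) (hH : H ≠ ⊤) :
    Ab (join G H) = max (Ab G + Fintype.card β) (Ab H + Fintype.card α) := by
  refine le_antisymm ?_ (max_le (Ab_add_card_le hG) ?_)
  · obtain ⟨c, hc, hk⟩ := (isGreatest_Ab (join G H)).1
    rw [← hk]
    rcases hc.1.injective_or_injective with h | h
    · apply le_max_of_le_right
      rw [← ncolors_comp_equiv (joinComm H G).toEquiv c]
      exact (hc.comap (joinComm H G)).ncolors_join_le h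
    · exact le_max_of_le_left (hc.ncolors_join_le h)
  · exact (Ab_add_card_le hH).trans (Ab_le_of_iso (joinComm G H))

end AcyclicB
end
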